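/- Every bicategory is biequivalent to a bicategory in which every equivalence 1-cell is an isomorphism (i.e., admits a strict two-sided inverse). -/

import Mathlib

open CategoryTheory Bicategory

universe w v u

namespace Paper

variable {B : Type*} [Bicategory B] {B' : Type*} [Bicategory B']

/-- A 1-cell `f : a ⟶ b` in a bicategory is an *equivalence* if there is `g : b ⟶ a`
with `f ≫ g ≅ 𝟙 a` and `g ≫ f ≅ 𝟙 b`. -/
def IsEquiv1Cell {a b : B} (f : a ⟶ b) : Prop :=
  ∃ g : b ⟶ a, Nonempty (f ≫ g ≅ 𝟙 a) ∧ Nonempty (g ≫ f ≅ 𝟙 b)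

/-- A 1-cell `f : a ⟶ b` is an *isomorphism* if it admits a strict two-sided inverse. -/
def IsIso1Cell {a b : B} (f : a ⟶ b) : Prop :=
  ∃ g : b ⟶ a, f ≫ g = 𝟙 a ∧ g ≫ f = 𝟙 b

/-- A pseudofunctor is a biequivalence if it is bi-essentially surjective and a local
equivalence of hom-categories. -/
structure IsBiequivalence (H : Pseudofunctor B B') : Prop where
  essSurj : ∀ c : B', ∃ (a : B) (f : H.obj a ⟶ c), IsEquiv1Cell f
  locEquiv : ∀ a b : B, (H.mapFunctor a b).IsEquivalence

section Skel

/-- Chosen representative of the isomorphism class of a 1-cell. -/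
noncomputable def rep {B : Type u} [Bicategory.{w, v} B] {a b : B} (f : a ⟶ b) : a ⟶ b :=
  Quotient.out (s := isIsomorphicSetoid (a ⟶ b)) (Quotient.mk _ f)

/-- A 1-cell is isomorphic to its representative. -/
noncomputable def rho {B : Type u} [Bicategory.{w, v} B] {a b : B} (f : a ⟶ b) : rep f ≅ f :=
  Classical.choice (Quotient.mk_out (s := isIsomorphicSetoid (a ⟶ b)) f)

theorem rep_eq {B : Type u} [Bicategory.{w, v} B] {a b : B} {f g : a ⟶ b} (e : f ≅ g) :
    rep f = rep g := by
  unfold rep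
  rw [Quotient.sound (s := isIsomorphicSetoid (a ⟶ b)) (a := f) (b := g) ⟨e⟩]

/-- Objects of the locally skeletal replacement. -/
structure SObj (B : Type u) [Bicategory.{w, v} B] : Type (max u (v + 1) (w + 1)) where
  of : B

/-- 1-cells of the locally skeletal replacement: chosen representatives. -/
structure SHom {B : Type u} [Bicategory.{w, v} B] (a b : SObj B) : Type (max u v w) where
  val : a.of ⟶ b.of
  prop : rep val = val

/-- 2-cells of the locally skeletal replacement. -/
@[ext]
structure SHom2 {B : Type u} [Bicategory.{w, v} B] {a b : SObj B} (f g : SHom a b) :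
    Type (max u v w) where
  hom : f.val ⟶ g.val

/-- The representative as a 1-cell of the replacement. -/
noncomputable def mkS {B : Type u} [Bicategory.{w, v} B] {a b : SObj B} (f : a.of ⟶ b.of) :
    SHom a b :=
  ⟨rep f, rep_eq (rho f)⟩

theorem SHom.eq_of_iso {B : Type u} [Bicategory.{w, v} B] {a b : SObj B} {f g : SHom a b}
    (e : f.val ≅ g.val) : f = g := by
  obtain ⟨f, hf⟩ := f
  obtain ⟨g, hg⟩ := g
  have : f = g := by rw [← hf, ← hg]; exact rep_eq e
  subst this
  rfl

instance homCat {B : Type u} [Bicategory.{w, v} B] (a b : SObj B) :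
    Category.{max u v w} (SHom a b) where
  Hom f g := SHom2 f g
  id f := ⟨𝟙 f.val⟩
  comp η θ := ⟨η.hom ≫ θ.hom⟩

@[ext]
theorem SHom.hom_ext {B : Type u} [Bicategory.{w, v} B] {a b : SObj B} {f g : SHom a b}
    {η θ : f ⟶ g} (h : SHom2.hom η = SHom2.hom θ) : η = θ := SHom2.ext h

@[simp]
theorem SHom.id_hom {B : Type u} [Bicategory.{w, v} B] {a b : SObj B} (f : SHom a b) :
    SHom2.hom (𝟙 f) = 𝟙 f.val := rfl

@[simp]
theorem SHom.comp_hom {B : Type u} [Bicategory.{w, v} B] {a b : SObj B} {f g h : SHom a b}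
    (η : f ⟶ g) (θ : g ⟶ h) : SHom2.hom (η ≫ θ) = SHom2.hom η ≫ SHom2.hom θ := rfl

/-- Lift an isomorphism. -/
@[simps]
def mkIso {B : Type u} [Bicategory.{w, v} B] {a b : SObj B} {f g : SHom a b}
    (e : f.val ≅ g.val) : f ≅ g where
  hom := ⟨e.hom⟩
  inv := ⟨e.inv⟩
  hom_inv_id := by ext; simp
  inv_hom_id := by ext; simp

/-- Underlying isomorphism. -/
@[simps]
def unIso {B : Type u} [Bicategory.{w, v} B] {a b : SObj B} {f g : SHom a b}
    (e : f ≅ g) : f.val ≅ g.val where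
  hom := SHom2.hom e.hom
  inv := SHom2.hom e.inv
  hom_inv_id := by rw [← SHom.comp_hom, e.hom_inv_id]; rfl
  inv_hom_id := by rw [← SHom.comp_hom, e.inv_hom_id]; rfl

theorem conjL {B : Type u} [Bicategory.{w, v} B] {a b c : B} {x y : a ⟶ b} (e : x ≅ y)
    {f g : b ⟶ c} (η : f ⟶ g) : x ◁ η = e.hom ▷ f ≫ y ◁ η ≫ e.inv ▷ g := by
  rw [whisker_exchange]; simp [← comp_whiskerRight_assoc]

theorem conjR {B : Type u} [Bicategory.{w, v} B] {a b c : B} {x y : b ⟶ c} (e : x ≅ y)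
    {f g : a ⟶ b} (η : f ⟶ g) : η ▷ x = f ◁ e.hom ≫ η ▷ y ≫ g ◁ e.inv := by
  rw [← whisker_exchange]; simp [← whiskerLeft_comp_assoc]

/-- The locally skeletal replacement. -/
noncomputable instance skelBicat (B : Type u) [Bicategory.{w, v} B] :
    Bicategory.{max u v w, max u v w} (SObj B) where
  Hom a b := SHom a b
  id a := mkS (𝟙 a.of)
  comp f g := mkS (f.val ≫ g.val)
  homCategory a b := homCat a b
  whiskerLeft f g h η := ⟨(rho (f.val ≫ g.val)).hom ≫ f.val ◁ η.hom ≫ (rho (f.val ≫ h.val)).inv⟩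
  whiskerRight {a b c f g} η h :=
    ⟨(rho (f.val ≫ h.val)).hom ≫ η.hom ▷ h.val ≫ (rho (g.val ≫ h.val)).inv⟩
  associator f g h := mkIso
    (rho (rep (f.val ≫ g.val) ≫ h.val) ≪≫ whiskerRightIso (rho (f.val ≫ g.val)) h.val ≪≫
      α_ f.val g.val h.val ≪≫ whiskerLeftIso f.val (rho (g.val ≫ h.val)).symm ≪≫
      (rho (f.val ≫ rep (g.val ≫ h.val))).symm)
  leftUnitor {a b} f := mkIso
    (rho (rep (𝟙 a.of) ≫ f.val) ≪≫ whiskerRightIso (rho (𝟙 a.of)) f.val ≪≫ λ_ f.val)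
  rightUnitor {a b} f := mkIso
    (rho (f.val ≫ rep (𝟙 b.of)) ≪≫ whiskerLeftIso f.val (rho (𝟙 b.of)) ≪≫ ρ_ f.val)
  whiskerLeft_id f g := by ext; simp [mkS]
  whiskerLeft_comp f g h i η θ := by ext; simp [mkS]
  id_whiskerLeft η := by ext; simp [mkS, conjL (rho (𝟙 _))]
  comp_whiskerLeft f g h h' η := by ext; simp [mkS, conjL (rho (f.val ≫ g.val))]
  id_whiskerRight f g := by ext; simp [mkS]
  comp_whiskerRight η θ i := by ext; simp [mkS]
  whiskerRight_id η := by ext; simp [mkS, conjR (rho (𝟙 _))]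
  whiskerRight_comp η g h := by ext; simp [mkS, conjR (rho (g.val ≫ h.val))]
  whisker_assoc f g g' η h := by ext; simp [mkS]
  whisker_exchange η θ := by ext; simp [mkS, whisker_exchange_assoc]
  pentagon f g h i := by ext; simp [mkS, whisker_exchange_assoc]
  triangle f g := by ext; simp [mkS]

/-- The comparison isomorphism for composition. -/
noncomputable def mc {B : Type u} [Bicategory.{w, v} B] {a b c : B} (f : a ⟶ b) (g : b ⟶ c) :
    rep (f ≫ g) ≅ rep (rep f ≫ rep g) :=
  rho (f ≫ g) ≪≫ whiskerRightIso (rho f).symm g ≪≫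
    whiskerLeftIso (rep f) (rho g).symm ≪≫ (rho (rep f ≫ rep g)).symm

/-- The inclusion into the locally skeletal replacement. -/
noncomputable def incl (B : Type u) [Bicategory.{w, v} B] : Pseudofunctor B (SObj B) where
  obj a := ⟨a⟩
  map f := mkS f
  map₂ {a b f g} η := ⟨(rho f).hom ≫ η ≫ (rho g).inv⟩
  map₂_id f := by
    apply SHom.hom_ext
    change (rho f).hom ≫ 𝟙 f ≫ (rho f).inv = 𝟙 (rep f)
    simp
  map₂_comp {a b f g h} η θ := by
    apply SHom.hom_ext
    change (rho f).hom ≫ (η ≫ θ) ≫ (rho h).inv =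
      ((rho f).hom ≫ η ≫ (rho g).inv) ≫ ((rho g).hom ≫ θ ≫ (rho h).inv)
    simp
  mapId a := Iso.refl _
  mapComp {a b c} f g := mkIso (mc f g)
  map₂_whisker_left f g h η := by
    apply SHom.hom_ext
    change (rho (f ≫ g)).hom ≫ f ◁ η ≫ (rho (f ≫ h)).inv =
      (mc f g).hom ≫ ((rho (rep f ≫ rep g)).hom ≫ rep f ◁ ((rho g).hom ≫ η ≫ (rho h).inv) ≫
        (rho (rep f ≫ rep h)).inv) ≫ (mc f h).inv
    simp [mc, conjL (rho f)]
  map₂_whisker_right {a b c f g} η h := by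
    apply SHom.hom_ext
    change (rho (f ≫ h)).hom ≫ η ▷ h ≫ (rho (g ≫ h)).inv =
      (mc f h).hom ≫ ((rho (rep f ≫ rep h)).hom ≫ ((rho f).hom ≫ η ≫ (rho g).inv) ▷ rep h ≫
        (rho (rep g ≫ rep h)).inv) ≫ (mc g h).inv
    simp [mc, conjR (rho h)]
  map₂_associator f g h := by
    apply SHom.hom_ext
    change (rho ((f ≫ g) ≫ h)).hom ≫ (α_ f g h).hom ≫ (rho (f ≫ g ≫ h)).inv =
      (mc (f ≫ g) h).hom ≫
      ((rho (rep (f ≫ g) ≫ rep h)).hom ≫ (mc f g).hom ▷ rep h ≫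
        (rho (rep (rep f ≫ rep g) ≫ rep h)).inv) ≫
      ((rho (rep (rep f ≫ rep g) ≫ rep h)).hom ≫ (rho (rep f ≫ rep g)).hom ▷ rep h ≫
        (α_ (rep f) (rep g) (rep h)).hom ≫ rep f ◁ (rho (rep g ≫ rep h)).inv ≫
        (rho (rep f ≫ rep (rep g ≫ rep h))).inv) ≫
      ((rho (rep f ≫ rep (rep g ≫ rep h))).hom ≫ rep f ◁ (mc g h).inv ≫
        (rho (rep f ≫ rep (g ≫ h))).inv) ≫
      (mc f (g ≫ h)).inv
    have e2 : (rho f).inv ▷ g ▷ rep h ≫ (α_ (rep f) g (rep h)).hom ≫ rep f ◁ g ◁ (rho h).hom =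
        (α_ f g (rep h)).hom ≫ f ◁ g ◁ (rho h).hom ≫ (α_ f g h).inv ≫ (rho f).inv ▷ g ▷ h ≫
          (α_ (rep f) g h).hom := by
      have := whisker_exchange ((rho f).inv ▷ g) (rho h).hom
      simp only [comp_whiskerLeft, Category.assoc] at this
      rw [← cancel_mono (α_ (rep f) g h).inv]
      simpa using this.symm
    simp only [mc, Iso.trans_hom, Iso.trans_inv, Iso.symm_hom, Iso.symm_inv, whiskerLeftIso_hom,
      whiskerLeftIso_inv, whiskerRightIso_hom, whiskerRightIso_inv]
    simp [whisker_exchange_assoc, reassoc_of% e2]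
  map₂_left_unitor {a b} f := by
    apply SHom.hom_ext
    change (rho (𝟙 a ≫ f)).hom ≫ (λ_ f).hom ≫ (rho f).inv =
      (mc (𝟙 a) f).hom ≫
      ((rho (rep (𝟙 a) ≫ rep f)).hom ≫ 𝟙 (rep (𝟙 a)) ▷ rep f ≫ (rho (rep (𝟙 a) ≫ rep f)).inv) ≫
      ((rho (rep (𝟙 a) ≫ rep f)).hom ≫ (rho (𝟙 a)).hom ▷ rep f ≫ (λ_ (rep f)).hom)
    simp [mc, conjL (rho (𝟙 a))]
  map₂_right_unitor {a b} f := by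
    apply SHom.hom_ext
    change (rho (f ≫ 𝟙 b)).hom ≫ (ρ_ f).hom ≫ (rho f).inv =
      (mc f (𝟙 b)).hom ≫
      ((rho (rep f ≫ rep (𝟙 b))).hom ≫ rep f ◁ 𝟙 (rep (𝟙 b)) ≫ (rho (rep f ≫ rep (𝟙 b))).inv) ≫
      ((rho (rep f ≫ rep (𝟙 b))).hom ≫ rep f ◁ (rho (𝟙 b)).hom ≫ (ρ_ (rep f)).hom)
    simp [mc]

end Skel

/-- Every bicategory is biequivalent to a bicategory in which every
equivalence 1-cell is an isomorphism. -/
theorem every_bicategory_biequivalent_to_one_where_equivalences_are_isos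
    (B : Type u) [Bicategory.{w, v} B] :
    ∃ (C : Type (max u (v + 1) (w + 1))) (_ : Bicategory.{max u v w, max u v w} C)
      (H : Pseudofunctor B C),
      IsBiequivalence H ∧
        ∀ (a b : C) (f : a ⟶ b), IsEquiv1Cell f → IsIso1Cell f := by
  refine ⟨SObj B, skelBicat B, incl B, ⟨?_, ?_⟩, ?_⟩
  · intro c
    exact ⟨c.of, 𝟙 c, 𝟙 c, ⟨λ_ _⟩, ⟨λ_ _⟩⟩
  · intro a b
    have h1 : ((incl B).mapFunctor a b).Faithful := ⟨by
      intro f g η θ h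
      have h' : (rho f).hom ≫ η ≫ (rho g).inv = (rho f).hom ≫ θ ≫ (rho g).inv :=
        congrArg SHom2.hom h
      simpa using h'⟩
    have h2 : ((incl B).mapFunctor a b).Full := ⟨by
      intro f g η
      refine ⟨(rho f).inv ≫ SHom2.hom η ≫ (rho g).hom, ?_⟩
      apply SHom.hom_ext
      have key : ∀ θ : rep f ⟶ rep g,
          (rho f).hom ≫ ((rho f).inv ≫ θ ≫ (rho g).hom) ≫ (rho g).inv = θ := by simp
      exact key (SHom2.hom η)⟩
    have h3 : ((incl B).mapFunctor a b).EssSurj := ⟨by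
      intro f
      exact ⟨f.val, ⟨mkIso (rho f.val)⟩⟩⟩
    exact { }
  · rintro a b f ⟨g, ⟨e⟩, ⟨e'⟩⟩
    exact ⟨g, SHom.eq_of_iso (unIso e), SHom.eq_of_iso (unIso e')⟩

end Paper
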